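/- If an n-element finite meet-semilattice S has fewer than 26·2^{n-6} congruences, then it has at most 25·2^{n-6} congruences; moreover |Con(S)| = 25·2^{n-6} if and only if S is a quasi-tree semilattice whose nucleus is either the six-element lattice F (two pentagon-free joins above a common three-element antichain: elements u < a, b, c with a∨b = v₁, b∨c = v₂, v₁ ∥ v₂, a∧b = a∧c = b∧c = u) or the six-element lattice N₆ ({u, a₁, a₂, a₃, b, v} with u < a₁ < a₂ < a₃ < v, u < b < v, b incomparable to each aᵢ). -/

import Mathlib

def IsMeetCong {α : Type*} [SemilatticeInf α] (s : Setoid α) : Prop :=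
  ∀ a b c d : α, s.r a b → s.r c d → s.r (a ⊓ c) (b ⊓ d)

noncomputable def numCong (α : Type*) [SemilatticeInf α] : ℕ :=
  Nat.card {s : Setoid α // IsMeetCong s}

def IsUbta {α : Type*} [SemilatticeInf α] [OrderBot α] (x y : α) : Prop :=
  x ≠ ⊥ ∧ y ≠ ⊥ ∧ ¬ x ≤ y ∧ ¬ y ≤ x ∧ ∃ z, x ≤ z ∧ y ≤ z

def treeCong (α : Type*) [SemilatticeInf α] [OrderBot α] : Setoid α :=
  sInf {s : Setoid α | IsMeetCong s ∧
    ∀ a b v : α, IsUbta a b → IsLUB {a, b} v → s.r (a ⊓ b) v}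

def IsNucleus {α : Type*} [SemilatticeInf α] [OrderBot α] (X : Set α) : Prop :=
  (∃ x ∈ X, ∃ y ∈ X, x ≠ y) ∧
  (∀ x ∈ X, ∀ y, y ∈ X ↔ (treeCong α).r x y) ∧
  (∀ a b : α, (treeCong α).r a b → a ≠ b → a ∈ X)

def IsQuasiTree (α : Type*) [SemilatticeInf α] [OrderBot α] : Prop :=
  ∃ X : Set α, IsNucleus X

/-- X is a copy of the six-element lattice F: bottom u, three-element antichain
a, b, c with pairwise meets u, and two incomparable coatoms v₁ = a∨b, v₂ = b∨c. -/
def IsFNucleus {α : Type*} [SemilatticeInf α] (X : Set α) : Prop :=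
  ∃ u a b c v₁ v₂ : α, X = {u, a, b, c, v₁, v₂} ∧
    u < a ∧ u < b ∧ u < c ∧
    a ⊓ b = u ∧ a ⊓ c = u ∧ b ⊓ c = u ∧
    IsLUB {a, b} v₁ ∧ IsLUB {b, c} v₂ ∧ ¬ v₁ ≤ v₂ ∧ ¬ v₂ ≤ v₁

/-- X is a copy of the six-element lattice N₆ = {u, a₁, a₂, a₃, b, v} with
u < a₁ < a₂ < a₃ < v, u < b < v, b incomparable to each aᵢ. -/
def IsN6Nucleus {α : Type*} [SemilatticeInf α] (X : Set α) : Prop :=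
  ∃ u a₁ a₂ a₃ b v : α, X = {u, a₁, a₂, a₃, b, v} ∧
    u < a₁ ∧ a₁ < a₂ ∧ a₂ < a₃ ∧ a₃ < v ∧ u < b ∧ b < v ∧
    ¬ a₁ ≤ b ∧ ¬ b ≤ a₁ ∧ ¬ a₂ ≤ b ∧ ¬ b ≤ a₂ ∧ ¬ a₃ ≤ b ∧ ¬ b ≤ a₃ ∧
    a₁ ⊓ b = u ∧ a₂ ⊓ b = u ∧ a₃ ⊓ b = u ∧
    IsLUB {a₁, b} v ∧ IsLUB {a₂, b} v ∧ IsLUB {a₃, b} v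

/-- `a` and `b` are incomparable with join `v`. -/
def IsJoinPair {α : Type*} [SemilatticeInf α] (a b v : α) : Prop :=
  ¬ a ≤ b ∧ ¬ b ≤ a ∧ IsLUB {a, b} v

/-- The set with indicator function `χ` is closed under all existing joins. -/
def IsJoinClosed {α : Type*} [SemilatticeInf α] (χ : α → Bool) : Prop :=
  ∀ a b v : α, IsJoinPair a b v → χ a → χ b → χ v

open Classical in
/-- The number of join-closed subsets. -/
noncomputable def numJoinClosed (α : Type*) [SemilatticeInf α] [Fintype α] : ℕ :=
  (Finset.univ.filter fun χ : α → Bool => IsJoinClosed χ).card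

section JoinPair

variable {α : Type*} [SemilatticeInf α]

theorem IsJoinPair.symm {a b v : α} (h : IsJoinPair a b v) : IsJoinPair b a v :=
  ⟨h.2.1, h.1, by rw [Set.pair_comm]; exact h.2.2⟩

theorem IsJoinPair.left_le {a b v : α} (h : IsJoinPair a b v) : a ≤ v :=
  h.2.2.1 (by simp)

theorem IsJoinPair.right_le {a b v : α} (h : IsJoinPair a b v) : b ≤ v :=
  h.2.2.1 (by simp)

theorem IsJoinPair.le {a b v z : α} (h : IsJoinPair a b v) (ha : a ≤ z) (hb : b ≤ z) : v ≤ z :=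
  h.2.2.2 (by simp [ha, hb])

theorem IsJoinPair.unique {a b v w : α} (h : IsJoinPair a b v) (h' : IsJoinPair a b w) : v = w :=
  h.2.2.unique h'.2.2

theorem IsJoinPair.ne {a b v : α} (h : IsJoinPair a b v) : a ≠ b :=
  fun e => h.1 e.le

theorem IsJoinPair.left_ne {a b v : α} (h : IsJoinPair a b v) : a ≠ v :=
  fun e => h.2.1 (h.right_le.trans e.ge)

theorem IsJoinPair.right_ne {a b v : α} (h : IsJoinPair a b v) : b ≠ v :=
  h.symm.left_ne

theorem IsJoinPair.isUbta [OrderBot α] {a b v : α} (h : IsJoinPair a b v) : IsUbta a b :=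
  ⟨fun e => h.1 (e ▸ bot_le), fun e => h.2.1 (e ▸ bot_le), h.1, h.2.1, v, h.left_le, h.right_le⟩

theorem exists_isLUB_pair [Finite α] {a b z : α} (ha : a ≤ z) (hb : b ≤ z) :
    ∃ v, IsLUB {a, b} v := by
  classical
  have := Fintype.ofFinite α
  have hne : (Finset.univ.filter fun x : α => a ≤ x ∧ b ≤ x).Nonempty := ⟨z, by simp [ha, hb]⟩
  refine ⟨Finset.inf' _ hne id, ?_, ?_⟩
  · rintro x (rfl | rfl) <;> refine Finset.le_inf' _ _ fun y hy => ?_ <;> simp at hy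
    exacts [hy.1, hy.2]
  · intro y hy
    exact Finset.inf'_le id (by simpa [upperBounds] using hy)

theorem exists_isJoinPair [Finite α] {a b z : α} (ha : a ≤ z) (hb : b ≤ z)
    (hab : ¬ a ≤ b) (hba : ¬ b ≤ a) : ∃ v, IsJoinPair a b v ∧ v ≤ z := by
  obtain ⟨v, hv⟩ := exists_isLUB_pair ha hb
  exact ⟨v, ⟨hab, hba, hv⟩, hv.2 (by simp [ha, hb])⟩

end JoinPair

section Duality

variable {α : Type*} [SemilatticeInf α]

theorem IsJoinClosed.of_isLUB {χ : α → Bool} (h : IsJoinClosed χ) {a b v : α}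
    (hv : IsLUB {a, b} v) (ha : χ a) (hb : χ b) : χ v := by
  by_cases hab : a ≤ b
  · have : v = b := le_antisymm (hv.2 (by simp [hab])) (hv.1 (by simp))
    rwa [this]
  by_cases hba : b ≤ a
  · have : v = a := le_antisymm (hv.2 (by simp [hba])) (hv.1 (by simp))
    rwa [this]
  exact h a b v ⟨hab, hba, hv⟩ ha hb

open Classical in
/-- The two-element set of a join pair is not join-closed. -/
theorem IsJoinPair.not_isJoinClosed {p q r : α} (h : IsJoinPair p q r) :
    ¬ IsJoinClosed fun x : α => decide (x = p ∨ x = q) := by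
  intro hc
  have := hc p q r h (by simp) (by simp)
  simp [h.left_ne.symm, h.right_ne.symm] at this

/-- The congruence identifying elements that lie above the same members of `χ`. -/
def sameBelow (χ : α → Bool) : Setoid α where
  r x y := ∀ w, χ w → (w ≤ x ↔ w ≤ y)
  iseqv := ⟨fun _ _ _ => Iff.rfl, fun h w hw => (h w hw).symm,
    fun h h' w hw => (h w hw).trans (h' w hw)⟩

theorem isMeetCong_sameBelow (χ : α → Bool) : IsMeetCong (sameBelow χ) := by
  intro a b c d hab hcd w hw
  rw [le_inf_iff, le_inf_iff, hab w hw, hcd w hw]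

open Classical in
/-- The elements whose principal filters are saturated. -/
noncomputable def saturated (s : Setoid α) (w : α) : Bool :=
  decide (∀ x y, s.r x y → w ≤ x → w ≤ y)

theorem saturated_iff {s : Setoid α} {w : α} :
    saturated s w ↔ ∀ x y, s.r x y → w ≤ x → w ≤ y := by
  simp [saturated]

theorem isJoinClosed_saturated (s : Setoid α) : IsJoinClosed (saturated s) := by
  intro a b v h ha hb
  rw [saturated_iff] at *
  exact fun x y hxy hx =>
    h.le (ha x y hxy (h.left_le.trans hx)) (hb x y hxy (h.right_le.trans hx))

theorem saturated_sameBelow [OrderBot α] [Finite α] {χ : α → Bool} (h : IsJoinClosed χ)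
    (h0 : χ ⊥) : saturated (sameBelow χ) = χ := by
  funext w
  rw [Bool.eq_iff_iff, saturated_iff]
  constructor
  · intro hw
    obtain ⟨m, hm⟩ := (Set.toFinite {x | χ x ∧ x ≤ w}).exists_maximal ⟨⊥, h0, bot_le⟩
    have hmax : ∀ x, χ x → x ≤ w → x ≤ m := by
      intro x hx hxw
      obtain ⟨v, hv⟩ := exists_isLUB_pair hm.prop.2 hxw
      have hmv : m ≤ v := hv.1 (by simp)
      have : v ≤ m := hm.le_of_ge
        ⟨h.of_isLUB hv hm.prop.1 hx, hv.2 (by simp [hm.prop.2, hxw])⟩ hmv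
      exact le_trans (hv.1 (by simp)) this
    have : w ≤ m := hw w m
      (fun x hx => ⟨hmax x hx, fun hxm => hxm.trans hm.prop.2⟩) le_rfl
    rw [le_antisymm this hm.prop.2]
    exact hm.prop.1
  · intro hw x y hxy hx
    exact (hxy w hw).1 hx

theorem exists_least_of_class [Finite α] {s : Setoid α} (hs : IsMeetCong s) (x : α) :
    ∃ m, s.r x m ∧ ∀ y, s.r x y → m ≤ y := by
  obtain ⟨m, hm⟩ := (Set.toFinite {y | s.r x y}).exists_minimal ⟨x, s.refl x⟩
  refine ⟨m, hm.prop, fun y hy => ?_⟩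
  have h : s.r x (m ⊓ y) := by simpa using hs x m x y hm.prop hy
  exact (hm.le_of_le h inf_le_left).trans inf_le_right

theorem sameBelow_saturated [Finite α] {s : Setoid α} (hs : IsMeetCong s) :
    sameBelow (saturated s) = s := by
  have key : ∀ x y m, (∀ w, saturated s w → (w ≤ x ↔ w ≤ y)) → s.r x m →
      (∀ z, s.r x z → m ≤ z) → m ≤ y ∧ saturated s m := by
    intro x y m hxy hm hmin
    have hsat : saturated s m := by
      rw [saturated_iff]
      intro p q hpq hmp
      have h := hs m m p q (s.refl m) hpq
      rw [inf_eq_left.2 hmp] at h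
      exact (hmin _ (s.trans hm h)).trans inf_le_right
    exact ⟨(hxy m hsat).1 (hmin x (s.refl x)), hsat⟩
  refine Setoid.ext fun x y => ⟨fun h => ?_, fun h w hw => ?_⟩
  · obtain ⟨m, hm, hmin⟩ := exists_least_of_class hs x
    obtain ⟨m', hm', hmin'⟩ := exists_least_of_class hs y
    obtain ⟨h1, hsat⟩ := key x y m h hm hmin
    obtain ⟨h2, hsat'⟩ := key y x m' (fun w hw => (h w hw).symm) hm' hmin'
    have e : m = m' := le_antisymm
      (saturated_iff.1 hsat _ _ hm' h1) (saturated_iff.1 hsat' _ _ hm h2)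
    exact s.trans hm (e ▸ s.symm hm')
  · rw [saturated_iff] at hw
    exact ⟨hw x y h, hw y x (s.symm h)⟩

open Classical in
theorem numCong_eq_card [OrderBot α] [Fintype α] :
    numCong α = (Finset.univ.filter fun χ : α → Bool => IsJoinClosed χ ∧ χ ⊥).card := by
  rw [numCong, ← Fintype.card_subtype, ← Nat.card_eq_fintype_card]
  refine Nat.card_congr
    { toFun := fun s => ⟨saturated s.1, isJoinClosed_saturated s.1,
        saturated_iff.2 fun _ _ _ _ => bot_le⟩
      invFun := fun χ => ⟨sameBelow χ.1, isMeetCong_sameBelow χ.1⟩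
      left_inv := fun s => Subtype.ext (sameBelow_saturated s.2)
      right_inv := fun χ => Subtype.ext (saturated_sameBelow χ.2.1 χ.2.2) }

theorem IsJoinClosed.update_bot [OrderBot α] [DecidableEq α] {χ : α → Bool}
    (h : IsJoinClosed χ) (t : Bool) : IsJoinClosed (Function.update χ ⊥ t) := by
  intro a b v hv
  have ha : a ≠ ⊥ := hv.isUbta.1
  have hb : b ≠ ⊥ := hv.isUbta.2.1
  have hv0 : v ≠ ⊥ := fun e => ha (le_bot_iff.1 (e ▸ hv.left_le))
  simpa [ha, hb, hv0] using h a b v hv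

theorem two_mul_numCong [OrderBot α] [Fintype α] : 2 * numCong α = numJoinClosed α := by
  classical
  have h : (Finset.univ.filter fun χ : α → Bool => IsJoinClosed χ ∧ χ ⊥).card =
      (Finset.univ.filter fun χ : α → Bool => IsJoinClosed χ ∧ ¬ χ ⊥).card := by
    refine Finset.card_nbij' (fun χ => Function.update χ ⊥ false)
      (fun χ => Function.update χ ⊥ true) ?_ ?_ ?_ ?_
    · intro χ hχ
      simp only [Finset.coe_filter, Finset.mem_univ, true_and, Set.mem_ofPred_eq] at hχ ⊢
      exact ⟨hχ.1.update_bot _, by simp⟩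
    · intro χ hχ
      simp only [Finset.coe_filter, Finset.mem_univ, true_and, Set.mem_ofPred_eq] at hχ ⊢
      exact ⟨hχ.1.update_bot _, by simp⟩
    · intro χ hχ
      simp only [Finset.coe_filter, Finset.mem_univ, true_and, Set.mem_ofPred_eq] at hχ
      simp [← hχ.2]
    · intro χ hχ
      simp only [Finset.coe_filter, Finset.mem_univ, true_and, Set.mem_ofPred_eq,
        Bool.not_eq_true] at hχ
      simp [← hχ.2]
  rw [numJoinClosed, ← Finset.card_filter_add_card_filter_not (fun χ : α → Bool => χ ⊥),
    Finset.filter_filter, Finset.filter_filter, ← h, two_mul, numCong_eq_card]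

end Duality

section Counting

variable {α : Type*} [Fintype α]

theorem card_filter_comp_mul {k : ℕ} [DecidableEq α] {f : Fin k → α}
    (hf : Function.Injective f) (D : (Fin k → Bool) → Bool) :
    (Finset.univ.filter fun χ : α → Bool => D (χ ∘ f)).card * 2 ^ k =
      (Finset.univ.filter fun p => D p).card * 2 ^ Fintype.card α := by
  classical
  let e : (α → Bool) ≃ (Fin k → Bool) × (↥(Set.range f)ᶜ → Bool) :=
    (Equiv.arrowCongr ((Equiv.sumCongr (Equiv.ofInjective f hf) (Equiv.refl _)).trans
      (Equiv.Set.sumCompl (Set.range f))).symm (Equiv.refl _)).trans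
      (Equiv.sumArrowEquivProdArrow _ _ _)
  have he : ∀ χ, (e χ).1 = χ ∘ f := fun χ => by
    funext i
    simp [e]
  have h1 : (Finset.univ.filter fun χ : α → Bool => D (χ ∘ f)).card =
      ((Finset.univ.filter fun p => D p) ×ˢ
        (Finset.univ : Finset (↥(Set.range f)ᶜ → Bool))).card := by
    refine Finset.card_equiv e fun χ => ?_
    simp [he]
  have h2 : Fintype.card ↥(Set.range f)ᶜ + k = Fintype.card α := by
    have := Fintype.card_congr ((Equiv.sumCongr (Equiv.ofInjective f hf) (Equiv.refl _)).trans
      (Equiv.Set.sumCompl (Set.range f)))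
    rw [Fintype.card_sum, Fintype.card_fin] at this
    omega
  rw [h1, Finset.card_product, ← h2, pow_add]
  simp [mul_assoc]

variable [SemilatticeInf α] {k : ℕ} {f : Fin k → α}

theorem numJoinClosed_mul_le (hf : Function.Injective f) (D : (Fin k → Bool) → Bool)
    (h : ∀ χ : α → Bool, IsJoinClosed χ → D (χ ∘ f)) :
    numJoinClosed α * 2 ^ k ≤
      (Finset.univ.filter fun p => D p).card * 2 ^ Fintype.card α := by
  classical
  rw [← card_filter_comp_mul hf]
  refine Nat.mul_le_mul_right _ (Finset.card_le_card fun χ hχ => ?_)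
  simpa using h χ (by simpa using hχ)

theorem numJoinClosed_mul_lt (hf : Function.Injective f) (D : (Fin k → Bool) → Bool)
    (h : ∀ χ : α → Bool, IsJoinClosed χ → D (χ ∘ f)) {χ : α → Bool}
    (hχ : D (χ ∘ f)) (hχ' : ¬ IsJoinClosed χ) :
    numJoinClosed α * 2 ^ k <
      (Finset.univ.filter fun p => D p).card * 2 ^ Fintype.card α := by
  classical
  rw [← card_filter_comp_mul hf]
  refine Nat.mul_lt_mul_of_pos_right (Finset.card_lt_card ?_) (by positivity)
  refine Finset.ssubset_iff_of_subset (fun χ hχ => ?_) |>.2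
    ⟨χ, by simpa using hχ, by simpa using hχ'⟩
  simpa using h χ (by simpa using hχ)

theorem numJoinClosed_mul_eq (hf : Function.Injective f) (D : (Fin k → Bool) → Bool)
    (h : ∀ χ : α → Bool, IsJoinClosed χ ↔ D (χ ∘ f)) :
    numJoinClosed α * 2 ^ k =
      (Finset.univ.filter fun p => D p).card * 2 ^ Fintype.card α := by
  classical
  rw [← card_filter_comp_mul hf, numJoinClosed]
  simp only [h]

end Counting

section Bounds

variable {α : Type*} [SemilatticeInf α]

/-- Membership pattern of a set closed under `a ∨ b = v₁` and `b ∨ c = v₂`. -/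
def fPattern (p : Fin 5 → Bool) : Bool := (!(p 0 && p 1) || p 3) && (!(p 1 && p 2) || p 4)

/-- Membership pattern of a set closed under `aᵢ ∨ b = v`. -/
def n6Pattern (p : Fin 5 → Bool) : Bool := !(p 3 && (p 0 || p 1 || p 2)) || p 4

/-- Membership pattern of a set closed under `a ∨ b = v` and `c ∨ d = v`. -/
def disjointPattern (p : Fin 5 → Bool) : Bool := !((p 0 && p 1) || (p 2 && p 3)) || p 4

theorem card_fPattern : (Finset.univ.filter fun p => fPattern p).card = 25 := by
  decide +kernel

theorem card_n6Pattern : (Finset.univ.filter fun p => n6Pattern p).card = 25 := by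
  decide +kernel

theorem card_disjointPattern : (Finset.univ.filter fun p => disjointPattern p).card = 25 := by
  decide +kernel

theorem IsJoinClosed.fPattern {a b c v w : α} (hab : IsJoinPair a b v)
    (hbc : IsJoinPair b c w) {χ : α → Bool} (h : IsJoinClosed χ) :
    fPattern (χ ∘ ![a, b, c, v, w]) := by
  have h1 := h a b v hab
  have h2 := h b c w hbc
  simp [_root_.fPattern]
  grind

theorem IsJoinClosed.n6Pattern {a₁ a₂ a₃ b v : α} (h₁ : IsJoinPair a₁ b v)
    (h₂ : IsJoinPair a₂ b v) (h₃ : IsJoinPair a₃ b v) {χ : α → Bool} (h : IsJoinClosed χ) :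
    n6Pattern (χ ∘ ![a₁, a₂, a₃, b, v]) := by
  have h1 := h a₁ b v h₁
  have h2 := h a₂ b v h₂
  have h3 := h a₃ b v h₃
  simp [_root_.n6Pattern]
  grind

theorem IsJoinClosed.disjointPattern {a b c d v : α} (hab : IsJoinPair a b v)
    (hcd : IsJoinPair c d v) {χ : α → Bool} (h : IsJoinClosed χ) :
    disjointPattern (χ ∘ ![a, b, c, d, v]) := by
  have h1 := h a b v hab
  have h2 := h c d v hcd
  simp [_root_.disjointPattern]
  grind

/-- The only joins of incomparable elements are `a ∨ b = v` and `b ∨ c = w`, with `v ≠ w`. -/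
structure IsFConfig (a b c v w : α) : Prop where
  left : IsJoinPair a b v
  right : IsJoinPair b c w
  ne : v ≠ w
  only : ∀ p q r : α, IsJoinPair p q r →
    (p = b ∧ (q = a ∨ q = c)) ∨ (q = b ∧ (p = a ∨ p = c))

/-- The only joins of incomparable elements are `aᵢ ∨ b = v`. -/
structure IsN6Config (a₁ a₂ a₃ b v : α) : Prop where
  fst : IsJoinPair a₁ b v
  snd : IsJoinPair a₂ b v
  thd : IsJoinPair a₃ b v
  ne₁₂ : a₁ ≠ a₂
  ne₁₃ : a₁ ≠ a₃
  ne₂₃ : a₂ ≠ a₃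
  only : ∀ p q r : α, IsJoinPair p q r →
    (p = b ∧ (q = a₁ ∨ q = a₂ ∨ q = a₃)) ∨ (q = b ∧ (p = a₁ ∨ p = a₂ ∨ p = a₃))

theorem injective_fConfig {a b c v w : α} (hab : IsJoinPair a b v)
    (hbc : IsJoinPair b c w) (hvw : v ≠ w) : Function.Injective ![a, b, c, v, w] := by
  have hac : a ≠ c := by rintro rfl; exact hvw (hab.unique hbc.symm)
  have haw : a ≠ w := by rintro rfl; exact hab.2.1 hbc.left_le
  have hcv : c ≠ v := by rintro rfl; exact hbc.1 hab.right_le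
  rw [← List.nodup_ofFn]
  simp [hab.ne, hab.left_ne, hab.right_ne, hbc.ne, hbc.left_ne, hbc.right_ne, hvw, hac, haw, hcv]

theorem injective_n6Config {a₁ a₂ a₃ b v : α} (h₁ : IsJoinPair a₁ b v)
    (h₂ : IsJoinPair a₂ b v) (h₃ : IsJoinPair a₃ b v) (h₁₂ : a₁ ≠ a₂) (h₁₃ : a₁ ≠ a₃)
    (h₂₃ : a₂ ≠ a₃) : Function.Injective ![a₁, a₂, a₃, b, v] := by
  rw [← List.nodup_ofFn]
  simp [h₁₂, h₁₃, h₂₃, h₁.ne, h₁.left_ne, h₁.right_ne, h₂.ne, h₂.left_ne, h₃.ne, h₃.left_ne]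

variable [Fintype α]

theorem numJoinClosed_of_no_pair (h : ∀ p q r : α, ¬ IsJoinPair p q r) :
    numJoinClosed α = 2 ^ Fintype.card α := by
  have : ∀ χ : α → Bool, IsJoinClosed χ := fun χ a b v hv => absurd hv (h a b v)
  simp [numJoinClosed, this]

theorem numJoinClosed_of_one_pair {a b v : α} (hab : IsJoinPair a b v)
    (h : ∀ p q r : α, IsJoinPair p q r → (p = a ∧ q = b) ∨ (p = b ∧ q = a)) :
    numJoinClosed α * 8 = 7 * 2 ^ Fintype.card α := by
  have hf : Function.Injective ![a, b, v] := by
    rw [← List.nodup_ofFn]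
    simp [hab.ne, hab.left_ne, hab.right_ne]
  refine (numJoinClosed_mul_eq hf (fun p => !(p 0 && p 1) || p 2) fun χ => ?_).trans ?_
  · have h1 : IsJoinClosed χ ↔ (χ a → χ b → χ v) := by
      refine ⟨fun hc => hc a b v hab, fun hc p q r hr hp hq => ?_⟩
      rcases h p q r hr with ⟨rfl, rfl⟩ | ⟨rfl, rfl⟩
      · rw [hr.unique hab]; exact hc hp hq
      · rw [hr.symm.unique hab]; exact hc hq hp
    rw [h1]
    simp
    grind
  · congr 1

theorem numJoinClosed_of_two_leaves {a b c v : α} (hab : IsJoinPair a b v)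
    (hac : IsJoinPair a c v) (hbc : b ≠ c)
    (h : ∀ p q r : α, IsJoinPair p q r →
      (p = a ∧ (q = b ∨ q = c)) ∨ (q = a ∧ (p = b ∨ p = c))) :
    numJoinClosed α * 16 = 13 * 2 ^ Fintype.card α := by
  have hf : Function.Injective ![a, b, c, v] := by
    rw [← List.nodup_ofFn]
    simp [hab.ne, hab.left_ne, hab.right_ne, hac.ne, hac.right_ne, hbc]
  refine (numJoinClosed_mul_eq hf (fun p => !(p 0 && (p 1 || p 2)) || p 3) fun χ => ?_).trans ?_
  · have h1 : IsJoinClosed χ ↔ (χ a → χ b ∨ χ c → χ v) := by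
      refine ⟨fun hc ha hbc => hbc.elim (hc a b v hab ha) (hc a c v hac ha),
        fun hc p q r hr hp hq => ?_⟩
      rcases h p q r hr with ⟨rfl, rfl | rfl⟩ | ⟨rfl, rfl | rfl⟩
      · rw [hr.unique hab]; exact hc hp (.inl hq)
      · rw [hr.unique hac]; exact hc hp (.inr hq)
      · rw [hr.symm.unique hab]; exact hc hq (.inl hp)
      · rw [hr.symm.unique hac]; exact hc hq (.inr hp)
    rw [h1]
    simp
    grind
  · congr 1

theorem IsFConfig.numJoinClosed_eq {a b c v w : α} (h : IsFConfig a b c v w) :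
    numJoinClosed α * 32 = 25 * 2 ^ Fintype.card α := by
  rw [← card_fPattern]
  refine numJoinClosed_mul_eq (injective_fConfig h.left h.right h.ne) _ fun χ =>
    ⟨fun hc => hc.fPattern h.left h.right, fun hD p q r hr hp hq => ?_⟩
  simp only [fPattern, Function.comp_apply] at hD
  rcases h.only p q r hr with ⟨rfl, rfl | rfl⟩ | ⟨rfl, rfl | rfl⟩
  · rw [hr.symm.unique h.left]; simp_all
  · rw [hr.unique h.right]; simp_all
  · rw [hr.unique h.left]; simp_all
  · rw [hr.symm.unique h.right]; simp_all

theorem IsN6Config.numJoinClosed_eq {a₁ a₂ a₃ b v : α} (h : IsN6Config a₁ a₂ a₃ b v) :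
    numJoinClosed α * 32 = 25 * 2 ^ Fintype.card α := by
  rw [← card_n6Pattern]
  refine numJoinClosed_mul_eq
    (injective_n6Config h.fst h.snd h.thd h.ne₁₂ h.ne₁₃ h.ne₂₃) _ fun χ =>
    ⟨fun hc => hc.n6Pattern h.fst h.snd h.thd, fun hD p q r hr hp hq => ?_⟩
  simp only [n6Pattern, Function.comp_apply] at hD
  have hrv : r = v := by
    rcases h.only p q r hr with ⟨rfl, rfl | rfl | rfl⟩ | ⟨rfl, rfl | rfl | rfl⟩
    exacts [hr.symm.unique h.fst, hr.symm.unique h.snd, hr.symm.unique h.thd,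
      hr.unique h.fst, hr.unique h.snd, hr.unique h.thd]
  rcases h.only p q r hr with ⟨rfl, rfl | rfl | rfl⟩ | ⟨rfl, rfl | rfl | rfl⟩ <;> simp_all

theorem numJoinClosed_lt_of_independent {a b c d v w : α} (hab : IsJoinPair a b v)
    (hcd : IsJoinPair c d w) (hvw : v ≠ w) (hac : a ≠ c) (had : a ≠ d) (hbc : b ≠ c)
    (hbd : b ≠ d) : numJoinClosed α * 32 < 25 * 2 ^ Fintype.card α := by
  have hpos : 0 < 2 ^ Fintype.card α := by positivity
  have chain : ∀ a b d v w : α, IsJoinPair a b v → IsJoinPair v d w → a ≠ d → b ≠ d →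
      numJoinClosed α * 32 < 25 * 2 ^ Fintype.card α := by
    intro a b d v w hab hvd had hbd
    have haw : a ≠ w := by rintro rfl; exact hab.2.1 (hab.right_le.trans hvd.left_le)
    have hbw : b ≠ w := by rintro rfl; exact hab.1 (hab.left_le.trans hvd.left_le)
    have hf : Function.Injective ![a, b, d, v, w] := by
      rw [← List.nodup_ofFn]
      simp [hab.ne, had, hab.left_ne, haw, hbd, hab.right_ne, hbw, hvd.ne.symm, hvd.right_ne,
        hvd.left_ne]
    have := numJoinClosed_mul_le hf
      (fun p => (!(p 0 && p 1) || p 3) && (!(p 2 && p 3) || p 4)) fun χ hχ => by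
        have h1 := hχ a b v hab
        have h2 := hχ v d w hvd
        simp
        grind
    rw [show (Finset.univ.filter fun p : Fin 5 → Bool =>
      ((!(p 0 && p 1) || p 3) && (!(p 2 && p 3) || p 4)) = true).card = 24 by
        decide +kernel] at this
    omega
  by_cases h1 : v = c
  · subst h1; exact chain a b d v w hab hcd had hbd
  by_cases h2 : v = d
  · subst h2; exact chain a b c v w hab hcd.symm hac hbc
  by_cases h3 : w = a
  · subst h3; exact chain c d b w v hcd hab hbc.symm hbd.symm
  by_cases h4 : w = b
  · subst h4; exact chain c d a w v hcd hab.symm hac.symm had.symm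
  have hf : Function.Injective ![a, b, c, d, v, w] := by
    rw [← List.nodup_ofFn]
    simp [hab.ne, hac, had, hab.left_ne, Ne.symm h3, hbc, hbd, hab.right_ne, Ne.symm h4, hcd.ne,
      Ne.symm h1, hcd.left_ne, Ne.symm h2, hcd.right_ne, hvw]
  have := numJoinClosed_mul_le hf
    (fun p => (!(p 0 && p 1) || p 4) && (!(p 2 && p 3) || p 5)) fun χ hχ => by
      have h1 := hχ a b v hab
      have h2 := hχ c d w hcd
      simp
      grind
  rw [show (Finset.univ.filter fun p : Fin 6 → Bool =>
    ((!(p 0 && p 1) || p 4) && (!(p 2 && p 3) || p 5)) = true).card = 49 by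
      decide +kernel] at this
  omega

theorem exists_cross_pair {a b c d v : α} (hab : IsJoinPair a b v) (hcd : IsJoinPair c d v) :
    ∃ p q r : α, IsJoinPair p q r ∧ (p = a ∨ p = b) ∧ (q = c ∨ q = d) := by
  by_contra! hcon
  have key : ∀ p q, (p = a ∨ p = b) → (q = c ∨ q = d) → p ≤ q ∨ q ≤ p := by
    intro p q hp hq
    by_contra! h
    have hpv : p ≤ v := by rcases hp with rfl | rfl <;> [exact hab.left_le; exact hab.right_le]
    have hqv : q ≤ v := by rcases hq with rfl | rfl <;> [exact hcd.left_le; exact hcd.right_le]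
    obtain ⟨r, hr, -⟩ := exists_isJoinPair hpv hqv h.1 h.2
    have := hcon p q r hr hp
    tauto
  rcases key a c (.inl rfl) (.inl rfl) with hac | hca
  · rcases key b c (.inr rfl) (.inl rfl) with hbc | hcb
    · exact hcd.2.1 (hcd.right_le.trans (hab.le hac hbc))
    · exact hab.1 (hac.trans hcb)
  · rcases key a d (.inl rfl) (.inr rfl) with had | hda
    · exact hcd.1 (hca.trans had)
    · exact hab.2.1 (hab.right_le.trans (hcd.le hca hda))

theorem numJoinClosed_lt_of_disjoint {a b c d v : α} (hab : IsJoinPair a b v)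
    (hcd : IsJoinPair c d v) (hac : a ≠ c) (had : a ≠ d) (hbc : b ≠ c)
    (hbd : b ≠ d) : numJoinClosed α * 32 < 25 * 2 ^ Fintype.card α := by
  classical
  obtain ⟨p, q, r, hr, hp, hq⟩ := exists_cross_pair hab hcd
  have hf : Function.Injective ![a, b, c, d, v] := by
    rw [← List.nodup_ofFn]
    simp [hab.ne, hac, had, hab.left_ne, hbc, hbd, hab.right_ne, hcd.ne, hcd.left_ne,
      hcd.right_ne]
  rw [← card_disjointPattern]
  refine numJoinClosed_mul_lt hf _ (fun χ hχ => hχ.disjointPattern hab hcd) ?_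
    hr.not_isJoinClosed
  have := hab.ne
  have := hcd.ne
  simp [disjointPattern]
  grind

theorem numJoinClosed_lt_of_triangle {a b c v : α} (hab : IsJoinPair a b v)
    (hac : IsJoinPair a c v) (hbc : IsJoinPair b c v) :
    numJoinClosed α * 32 < 25 * 2 ^ Fintype.card α := by
  have hpos : 0 < 2 ^ Fintype.card α := by positivity
  have hf : Function.Injective ![a, b, c, v] := by
    rw [← List.nodup_ofFn]
    simp [hab.ne, hac.ne, hab.left_ne, hbc.ne, hab.right_ne, hac.right_ne]
  have := numJoinClosed_mul_le hf
    (fun p => !((p 0 && p 1) || (p 0 && p 2) || (p 1 && p 2)) || p 3) fun χ hχ => by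
      have h1 := hχ a b v hab
      have h2 := hχ a c v hac
      have h3 := hχ b c v hbc
      simp
      grind
  rw [show (Finset.univ.filter fun p : Fin 4 → Bool =>
    (!((p 0 && p 1) || (p 0 && p 2) || (p 1 && p 2)) || p 3) = true).card = 12 by
      decide +kernel] at this
  omega

theorem numJoinClosed_lt_or_isFConfig {a b c v w : α} (hab : IsJoinPair a b v)
    (hbc : IsJoinPair b c w) (hvw : v ≠ w) :
    numJoinClosed α * 32 < 25 * 2 ^ Fintype.card α ∨ IsFConfig a b c v w := by
  classical
  refine or_iff_not_imp_right.2 fun h => ?_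
  have : ∃ p q r : α, IsJoinPair p q r ∧
      ¬ ((p = b ∧ (q = a ∨ q = c)) ∨ (q = b ∧ (p = a ∨ p = c))) := by
    by_contra! hcon
    exact h ⟨hab, hbc, hvw, hcon⟩
  obtain ⟨p, q, r, hr, hpq⟩ := this
  rw [← card_fPattern]
  refine numJoinClosed_mul_lt (injective_fConfig hab hbc hvw) _
    (fun χ hχ => hχ.fPattern hab hbc) ?_ hr.not_isJoinClosed
  have := hab.ne
  have := hbc.ne
  simp [fPattern]
  grind

theorem numJoinClosed_lt_or_isN6Config {a₁ a₂ a₃ b v : α} (h₁ : IsJoinPair a₁ b v)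
    (h₂ : IsJoinPair a₂ b v) (h₃ : IsJoinPair a₃ b v) (h₁₂ : a₁ ≠ a₂) (h₁₃ : a₁ ≠ a₃)
    (h₂₃ : a₂ ≠ a₃) :
    numJoinClosed α * 32 < 25 * 2 ^ Fintype.card α ∨ IsN6Config a₁ a₂ a₃ b v := by
  classical
  refine or_iff_not_imp_right.2 fun h => ?_
  have : ∃ p q r : α, IsJoinPair p q r ∧
      ¬ ((p = b ∧ (q = a₁ ∨ q = a₂ ∨ q = a₃)) ∨ (q = b ∧ (p = a₁ ∨ p = a₂ ∨ p = a₃))) := by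
    by_contra! hcon
    exact h ⟨h₁, h₂, h₃, h₁₂, h₁₃, h₂₃, hcon⟩
  obtain ⟨p, q, r, hr, hpq⟩ := this
  rw [← card_n6Pattern]
  refine numJoinClosed_mul_lt (injective_n6Config h₁ h₂ h₃ h₁₂ h₁₃ h₂₃) _
    (fun χ hχ => hχ.n6Pattern h₁ h₂ h₃) ?_ hr.not_isJoinClosed
  have := h₁.ne
  have := h₂.ne
  have := h₃.ne
  simp [n6Pattern]
  grind

theorem numJoinClosed_lt_or_config (h : numJoinClosed α * 32 < 26 * 2 ^ Fintype.card α) :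
    numJoinClosed α * 32 < 25 * 2 ^ Fintype.card α ∨
      (∃ a b c v w : α, IsFConfig a b c v w) ∨
      ∃ a₁ a₂ a₃ b v : α, IsN6Config a₁ a₂ a₃ b v := by
  refine or_iff_not_imp_left.2 fun hlt => ?_
  by_contra! hcon
  obtain ⟨hF, hN⟩ := hcon
  have hpos : 0 < 2 ^ Fintype.card α := by positivity
  have same : ∀ a b c v w : α, IsJoinPair a b v → IsJoinPair a c w → v = w := by
    intro a b c v w hab hac
    by_contra hvw
    exact (numJoinClosed_lt_or_isFConfig hab.symm hac hvw).elim hlt (hF b a c v w)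
  have meet : ∀ a b c d v w : α, IsJoinPair a b v → IsJoinPair c d w →
      a = c ∨ a = d ∨ b = c ∨ b = d := by
    intro a b c d v w hab hcd
    by_contra! hne
    obtain ⟨h1, h2, h3, h4⟩ := hne
    by_cases hvw : v = w
    · subst hvw
      exact hlt (numJoinClosed_lt_of_disjoint hab hcd h1 h2 h3 h4)
    · exact hlt (numJoinClosed_lt_of_independent hab hcd hvw h1 h2 h3 h4)
  have triangle : ∀ a b c v₁ v₂ v₃ : α, IsJoinPair a b v₁ → IsJoinPair a c v₂ →
      IsJoinPair b c v₃ → False := by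
    intro a b c v₁ v₂ v₃ hab hac hbc
    obtain rfl := same _ _ _ _ _ hab hac
    obtain rfl := same _ _ _ _ _ hac.symm hbc.symm
    exact hlt (numJoinClosed_lt_of_triangle hab hac hbc)
  have star : ∀ b a₁ a₂ a₃ v₁ v₂ v₃ : α, IsJoinPair b a₁ v₁ → IsJoinPair b a₂ v₂ →
      IsJoinPair b a₃ v₃ → a₁ ≠ a₂ → a₁ = a₃ ∨ a₂ = a₃ := by
    intro b a₁ a₂ a₃ v₁ v₂ v₃ h₁ h₂ h₃ h₁₂
    by_contra! hne
    obtain rfl := same _ _ _ _ _ h₁ h₂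
    obtain rfl := same _ _ _ _ _ h₁ h₃
    exact (numJoinClosed_lt_or_isN6Config h₁.symm h₂.symm h₃.symm h₁₂ hne.1 hne.2).elim hlt
      (hN _ _ _ _ _)
  by_cases h0 : ∀ p q r : α, ¬ IsJoinPair p q r
  · have := numJoinClosed_of_no_pair h0
    omega
  push Not at h0
  obtain ⟨a, b, v, hab⟩ := h0
  by_cases h1 : ∀ p q r : α, IsJoinPair p q r → (p = a ∧ q = b) ∨ (p = b ∧ q = a)
  · have := numJoinClosed_of_one_pair hab h1
    omega
  have h2 : ∀ a b c v w : α, IsJoinPair a b v → IsJoinPair a c w → b ≠ c → False := by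
    intro a b c v w hab hac hbc
    obtain rfl := same _ _ _ _ _ hab hac
    have := numJoinClosed_of_two_leaves hab hac hbc fun p q r hr => by
      have m1 := meet _ _ _ _ _ _ hr hab
      have m2 := meet _ _ _ _ _ _ hr hac
      by_cases hpa : p = a
      · subst hpa
        exact .inl ⟨rfl, (star _ _ _ _ _ _ _ hab hac hr hbc).imp Eq.symm Eq.symm⟩
      by_cases hqa : q = a
      · subst hqa
        exact .inr ⟨rfl, (star _ _ _ _ _ _ _ hab hac hr.symm hbc).imp Eq.symm Eq.symm⟩
      exfalso
      have : (p = b ∧ q = c) ∨ (p = c ∧ q = b) := by grind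
      rcases this with ⟨rfl, rfl⟩ | ⟨rfl, rfl⟩
      · exact triangle _ _ _ _ _ _ hab hac hr
      · exact triangle _ _ _ _ _ _ hab hac hr.symm
    omega
  refine h1 fun p q r hr => ?_
  rcases meet _ _ _ _ _ _ hr hab with rfl | rfl | rfl | rfl
  · by_cases e : q = b
    · exact .inl ⟨rfl, e⟩
    · exact (h2 _ _ _ _ _ hr hab e).elim
  · by_cases e : q = a
    · exact .inr ⟨rfl, e⟩
    · exact (h2 _ _ _ _ _ hr hab.symm e).elim
  · by_cases e : p = b
    · exact .inr ⟨e, rfl⟩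
    · exact (h2 _ _ _ _ _ hr.symm hab e).elim
  · by_cases e : p = a
    · exact .inl ⟨e, rfl⟩
    · exact (h2 _ _ _ _ _ hr.symm hab.symm e).elim

end Bounds

section Nucleus

variable {α : Type*} [SemilatticeInf α]

/-- The equivalence whose only possibly nonsingleton block is `X`. -/
def collapse (X : Set α) : Setoid α where
  r x y := x = y ∨ (x ∈ X ∧ y ∈ X)
  iseqv := ⟨fun _ => .inl rfl, by grind, by grind⟩

theorem isMeetCong_collapse [Finite α] {X : Set α} {u : α}
    (hle : ∀ x ∈ X, u ≤ x) (hconv : ∀ x ∈ X, ∀ y, u ≤ y → y ≤ x → y ∈ X)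
    (hu : ∀ q r, ¬ IsJoinPair u q r) : IsMeetCong (collapse X) := by
  have key : ∀ a b c, (collapse X).r a b → (collapse X).r (a ⊓ c) (b ⊓ c) := by
    rintro a b c (rfl | ⟨ha, hb⟩)
    · exact .inl rfl
    by_cases huc : u ≤ c
    · exact .inr ⟨hconv a ha _ (le_inf (hle a ha) huc) inf_le_left,
        hconv b hb _ (le_inf (hle b hb) huc) inf_le_left⟩
    have : ∀ x ∈ X, x ⊓ c = u ⊓ c := by
      intro x hx
      refine le_antisymm (le_inf ?_ inf_le_right) (inf_le_inf_right _ (hle x hx))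
      by_contra hxu
      obtain ⟨v, hv, -⟩ := exists_isJoinPair (hle x hx) (inf_le_left : x ⊓ c ≤ x)
        (fun h => huc (h.trans inf_le_right)) hxu
      exact hu _ _ hv
    exact .inl ((this a ha).trans (this b hb).symm)
  intro a b c d hab hcd
  refine (collapse X).trans (key a b c hab) ?_
  simpa only [inf_comm b] using key c d b hcd

variable [OrderBot α]

theorem isMeetCong_treeCong : IsMeetCong (treeCong α) :=
  fun a b c d hab hcd s hs => hs.1 a b c d (hab s hs) (hcd s hs)

theorem IsJoinPair.treeCong_rel {a b v : α} (h : IsJoinPair a b v) :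
    (treeCong α).r (a ⊓ b) v :=
  fun _ hs => hs.2 a b v h.isUbta h.2.2

theorem IsJoinPair.treeCong_rel_of_le {a b v x : α} (h : IsJoinPair a b v) (hx : a ⊓ b ≤ x)
    (hxv : x ≤ v) : (treeCong α).r (a ⊓ b) x := by
  have := isMeetCong_treeCong _ _ x x h.treeCong_rel ((treeCong α).refl x)
  rwa [inf_eq_left.2 hx, inf_eq_right.2 hxv] at this

theorem IsNucleus.mem_of_isJoinPair {X : Set α} (hX : IsNucleus X) {a b v : α}
    (h : IsJoinPair a b v) : a ∈ X ∧ b ∈ X ∧ v ∈ X := by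
  have hne : a ⊓ b ≠ v := fun e => h.2.1 (h.right_le.trans (e ▸ inf_le_left))
  have hm := hX.2.2 _ _ h.treeCong_rel hne
  exact ⟨(hX.2.1 _ hm _).2 (h.treeCong_rel_of_le inf_le_left h.left_le),
    (hX.2.1 _ hm _).2 (h.treeCong_rel_of_le inf_le_right h.right_le),
    (hX.2.1 _ hm _).2 h.treeCong_rel⟩

theorem isNucleus_of_isJoinPair [Finite α] {X : Set α} {u x₀ : α} (hx₀ : x₀ ∈ X) (hne : x₀ ≠ u)
    (huX : u ∈ X) (hle : ∀ x ∈ X, u ≤ x) (hconv : ∀ x ∈ X, ∀ y, u ≤ y → y ≤ x → y ∈ X)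
    (hmeet : ∀ p q r, IsJoinPair p q r → p ⊓ q = u ∧ r ∈ X)
    (hcover : ∀ x ∈ X, ∃ p q r, IsJoinPair p q r ∧ x ≤ r) : IsNucleus X := by
  have hu : ∀ q r, ¬ IsJoinPair u q r := fun q r h => h.1 (inf_eq_left.1 (hmeet _ _ _ h).1)
  have hrel : ∀ x y, (treeCong α).r x y ↔ (x = y ∨ (x ∈ X ∧ y ∈ X)) := by
    intro x y
    constructor
    · intro h
      refine h (collapse X) ⟨isMeetCong_collapse hle hconv hu, fun a b v hab hv => ?_⟩
      obtain ⟨h1, h2⟩ := hmeet a b v ⟨hab.2.2.1, hab.2.2.2.1, hv⟩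
      exact .inr ⟨h1 ▸ huX, h2⟩
    · have key : ∀ x ∈ X, (treeCong α).r u x := by
        intro x hx
        obtain ⟨p, q, r, h, hxr⟩ := hcover x hx
        have e := (hmeet _ _ _ h).1
        have := h.treeCong_rel_of_le (e ▸ hle x hx) hxr
        rwa [e] at this
      rintro (rfl | ⟨hx, hy⟩)
      · exact (treeCong α).refl x
      · exact (treeCong α).trans ((treeCong α).symm (key x hx)) (key y hy)
  refine ⟨⟨x₀, hx₀, u, huX, hne⟩, fun x hx y => ?_, fun a b hab hne => ?_⟩
  · rw [hrel]
    grind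
  · exact (((hrel a b).1 hab).resolve_left hne).1

theorem IsNucleus.exists_isFConfig {X : Set α} (hX : IsNucleus X) (hF : IsFNucleus X) :
    ∃ a b c v w : α, IsFConfig a b c v w := by
  obtain ⟨u, a, b, c, v, w, rfl, hua, hub, huc, hab, hac, hbc, hv, hw, hvw, hwv⟩ := hF
  have nab : ¬ a ≤ b := fun h => hua.ne (by rw [← hab, inf_eq_left.2 h])
  have nba : ¬ b ≤ a := fun h => hub.ne (by rw [← hab, inf_eq_right.2 h])
  have nbc : ¬ b ≤ c := fun h => hub.ne (by rw [← hbc, inf_eq_left.2 h])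
  have ncb : ¬ c ≤ b := fun h => huc.ne (by rw [← hbc, inf_eq_right.2 h])
  have nac : ¬ a ≤ c := fun h => hua.ne (by rw [← hac, inf_eq_left.2 h])
  have nca : ¬ c ≤ a := fun h => huc.ne (by rw [← hac, inf_eq_right.2 h])
  have jab : IsJoinPair a b v := ⟨nab, nba, hv⟩
  have jbc : IsJoinPair b c w := ⟨nbc, ncb, hw⟩
  have naw : ¬ a ≤ w := fun h => hvw (jab.le h jbc.left_le)
  have ncv : ¬ c ≤ v := fun h => hwv (jbc.le jab.right_le h)
  refine ⟨a, b, c, v, w, jab, jbc, fun e => hvw e.le, fun p q r hr => ?_⟩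
  obtain ⟨hp, hq, hrX⟩ := hX.mem_of_isJoinPair hr
  have hpr := hr.left_le
  have hqr := hr.right_le
  have hpq := hr.1
  have hqp := hr.2.1
  have hav := jab.left_le
  have hbv := jab.right_le
  have hbw := jbc.left_le
  have hcw := jbc.right_le
  have below_v : ∀ z ∈ ({u, a, b, c, v, w} : Set α), z ≤ v → z = u ∨ z = a ∨ z = b ∨ z = v := by
    rintro z (rfl | rfl | rfl | rfl | rfl | rfl) hz <;> simp_all
  have below_w : ∀ z ∈ ({u, a, b, c, v, w} : Set α), z ≤ w → z = u ∨ z = b ∨ z = c ∨ z = w := by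
    rintro z (rfl | rfl | rfl | rfl | rfl | rfl) hz <;> simp_all
  have hr' : r ≤ v ∨ r ≤ w := by
    rcases hrX with rfl | rfl | rfl | rfl | rfl | rfl
    exacts [.inl (hua.le.trans hav), .inl hav, .inl hbv, .inr hcw, .inl le_rfl, .inr le_rfl]
  have hu : ∀ z ∈ ({u, a, b, c, v, w} : Set α), u ≤ z := by
    rintro z (rfl | rfl | rfl | rfl | rfl | rfl)
    exacts [le_rfl, hua.le, hub.le, huc.le, hua.le.trans hav, hub.le.trans hbw]
  have hup := hu p hp
  have huq := hu q hq
  rcases hr' with h | h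
  · rcases below_v p hp (hpr.trans h) with rfl | rfl | rfl | rfl <;>
      rcases below_v q hq (hqr.trans h) with rfl | rfl | rfl | rfl <;> simp_all
  · rcases below_w p hp (hpr.trans h) with rfl | rfl | rfl | rfl <;>
      rcases below_w q hq (hqr.trans h) with rfl | rfl | rfl | rfl <;> simp_all

theorem IsNucleus.exists_isN6Config {X : Set α} (hX : IsNucleus X) (hN : IsN6Nucleus X) :
    ∃ a₁ a₂ a₃ b v : α, IsN6Config a₁ a₂ a₃ b v := by
  obtain ⟨u, a₁, a₂, a₃, b, v, rfl, hu1, h12, h23, h3v, hub, hbv, n1, n1', n2, n2', n3, n3', -,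
    -, -, l1, l2, l3⟩ := hN
  refine ⟨a₁, a₂, a₃, b, v, ⟨n1, n1', l1⟩, ⟨n2, n2', l2⟩, ⟨n3, n3', l3⟩, h12.ne, (h12.trans h23).ne,
    h23.ne, fun p q r hr => ?_⟩
  obtain ⟨hp, hq, -⟩ := hX.mem_of_isJoinPair hr
  have hpq := hr.1
  have hqp := hr.2.1
  have h13 := h12.le.trans h23.le
  have hu : ∀ z ∈ ({u, a₁, a₂, a₃, b, v} : Set α), u ≤ z ∧ z ≤ v := by
    rintro z (rfl | rfl | rfl | rfl | rfl | rfl) <;> constructor <;> order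
  obtain ⟨hup, hpv⟩ := hu p hp
  obtain ⟨huq, hqv⟩ := hu q hq
  have h12' := h12.le
  have h23' := h23.le
  rcases hp with rfl | rfl | rfl | rfl | rfl | rfl <;>
    rcases hq with rfl | rfl | rfl | rfl | rfl | rfl <;>
      first
      | exact absurd ‹_› hpq
      | exact absurd ‹_› hqp
      | exact absurd le_rfl hpq
      | simp

theorem IsFConfig.exists_isNucleus [Finite α] {a b c v w : α} (h : IsFConfig a b c v w) :
    ∃ X : Set α, IsNucleus X ∧ IsFNucleus X := by
  have jab := h.left
  have jbc := h.right
  have hav := jab.left_le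
  have hbv := jab.right_le
  have hbw := jbc.left_le
  have hcw := jbc.right_le
  have hvw : ¬ v ≤ w := by
    intro hle
    refine (em (c ≤ v)).elim (fun hc => h.ne (le_antisymm hle (jbc.le hbv hc))) fun hc => ?_
    by_cases hvc : v ≤ c
    · exact jbc.1 (hbv.trans hvc)
    obtain ⟨r, hr, -⟩ := exists_isJoinPair hle hcw hvc hc
    have := h.only _ _ _ hr
    have := jab.left_ne
    have := jab.right_ne
    have := jbc.ne
    have := jbc.right_ne
    grind
  have hwv : ¬ w ≤ v := by
    intro hle
    refine (em (a ≤ w)).elim (fun ha => h.ne (le_antisymm (jab.le ha hbw) hle)) fun ha => ?_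
    by_cases hwa : w ≤ a
    · exact jab.2.1 (hbw.trans hwa)
    obtain ⟨r, hr, -⟩ := exists_isJoinPair hle hav hwa ha
    have := h.only _ _ _ hr
    have := jab.ne
    have := jab.right_ne
    have := jbc.left_ne
    have := jbc.right_ne
    grind
  have nac : ¬ a ≤ c := fun e => hvw (jab.le (e.trans hcw) hbw)
  have nca : ¬ c ≤ a := fun e => hwv (jbc.le hbv (e.trans hav))
  have naw : ¬ a ≤ w := fun e => hvw (jab.le e hbw)
  have ncv : ¬ c ≤ v := fun e => hwv (jbc.le hbv e)
  have comp : ∀ x y z, x ≤ z → y ≤ z → x ≠ a → x ≠ b → x ≠ c → x ≤ y ∨ y ≤ x := by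
    intro x y z hx hy ha hb hc
    by_contra! hxy
    obtain ⟨r, hr, -⟩ := exists_isJoinPair hx hy hxy.1 hxy.2
    have := h.only _ _ _ hr
    grind
  have hab_le : ∀ x, x ≤ a → x ≠ a → x ≤ b := by
    intro x hx hxa
    rcases comp x b v (hx.trans hav) hbv hxa (fun e => jab.2.1 (e ▸ hx)) (fun e => nca (e ▸ hx))
      with h1 | h1
    exacts [h1, (jab.2.1 (h1.trans hx)).elim]
  have hba_le : ∀ x, x ≤ b → x ≠ b → x ≤ a := by
    intro x hx hxb
    rcases comp x a v (hx.trans hbv) hav (fun e => jab.1 (e ▸ hx)) hxb (fun e => jbc.2.1 (e ▸ hx))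
      with h1 | h1
    exacts [h1, (jab.1 (h1.trans hx)).elim]
  have hbc_le : ∀ x, x ≤ b → x ≠ b → x ≤ c := by
    intro x hx hxb
    rcases comp x c w (hx.trans hbw) hcw (fun e => jab.1 (e ▸ hx)) hxb (fun e => jbc.2.1 (e ▸ hx))
      with h1 | h1
    exacts [h1, (jbc.2.1 (h1.trans hx)).elim]
  have hub : a ⊓ b ≠ b := fun e => jab.2.1 (inf_eq_right.1 e)
  have hua : a ⊓ b ≠ a := fun e => jab.1 (inf_eq_left.1 e)
  have hucle : a ⊓ b ≤ c := hbc_le _ inf_le_right hub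
  have huc : a ⊓ b ≠ c := fun e => nca (e ▸ inf_le_left)
  have hac : a ⊓ c = a ⊓ b := le_antisymm
    (le_inf inf_le_left (hab_le _ inf_le_left fun e => nac (inf_eq_left.1 e)))
    (le_inf inf_le_left hucle)
  have hbc : b ⊓ c = a ⊓ b := le_antisymm
    (le_inf (hba_le _ inf_le_left fun e => jbc.1 (inf_eq_left.1 e)) inf_le_left)
    (le_inf inf_le_right hucle)
  have key : ∀ p q r, IsJoinPair p q r → p ⊓ q = a ⊓ b ∧ (r = v ∨ r = w) := by
    intro p q r hr
    rcases h.only p q r hr with ⟨rfl, rfl | rfl⟩ | ⟨rfl, rfl | rfl⟩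
    exacts [⟨inf_comm _ _, .inl (hr.symm.unique jab)⟩, ⟨hbc, .inr (hr.unique jbc)⟩,
      ⟨rfl, .inl (hr.unique jab)⟩, ⟨(inf_comm _ _).trans hbc, .inr (hr.symm.unique jbc)⟩]
  refine ⟨{a ⊓ b, a, b, c, v, w}, ?_, a ⊓ b, a, b, c, v, w, rfl, inf_le_left.lt_of_ne hua,
    inf_le_right.lt_of_ne hub, hucle.lt_of_ne huc, rfl, hac, hbc, jab.2.2, jbc.2.2, hvw, hwv⟩
  refine isNucleus_of_isJoinPair (u := a ⊓ b) (x₀ := a) (by simp) hua.symm (by simp) ?_ ?_ ?_ ?_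
  · rintro x (rfl | rfl | rfl | rfl | rfl | rfl)
    exacts [le_rfl, inf_le_left, inf_le_right, hucle, inf_le_left.trans hav,
      inf_le_right.trans hbw]
  · intro x hx y huy hyx
    have hy : y ≤ v ∨ y ≤ w := by
      rcases hx with rfl | rfl | rfl | rfl | rfl | rfl
      exacts [.inl (hyx.trans (inf_le_left.trans hav)), .inl (hyx.trans hav), .inl (hyx.trans hbv),
        .inr (hyx.trans hcw), .inl hyx, .inr hyx]
    by_cases ya : y = a
    · simp [ya]
    by_cases yb : y = b
    · simp [yb]
    by_cases yc : y = c
    · simp [yc]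
    rcases hy with hy | hy
    · rcases comp y a v hy hav ya yb yc with h1 | h1
      · simp [le_antisymm (le_inf h1 (hab_le y h1 ya)) huy]
      · rcases comp y b v hy hbv ya yb yc with h2 | h2
        · exact (jab.1 (h1.trans h2)).elim
        · simp [le_antisymm hy (jab.le h1 h2)]
    · rcases comp y b w hy hbw ya yb yc with h1 | h1
      · simp [le_antisymm (le_inf (hba_le y h1 yb) h1) huy]
      · rcases comp y c w hy hcw ya yb yc with h2 | h2
        · exact (jbc.1 (h1.trans h2)).elim
        · simp [le_antisymm hy (jbc.le h1 h2)]
  · intro p q r hr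
    obtain ⟨h1, rfl | rfl⟩ := key p q r hr <;> exact ⟨h1, by simp⟩
  · rintro x (rfl | rfl | rfl | rfl | rfl | rfl)
    exacts [⟨_, _, _, jab, inf_le_left.trans hav⟩, ⟨_, _, _, jab, hav⟩, ⟨_, _, _, jab, hbv⟩,
      ⟨_, _, _, jbc, hcw⟩, ⟨_, _, _, jab, le_rfl⟩, ⟨_, _, _, jbc, le_rfl⟩]

theorem IsN6Config.exists_isNucleus [Finite α] {a₁ a₂ a₃ b v : α}
    (h : IsN6Config a₁ a₂ a₃ b v) : ∃ X : Set α, IsNucleus X ∧ IsN6Nucleus X := by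
  -- the elements other than `b` below `v` form a chain, so the `aᵢ` may be sorted
  have chain : ∀ x y, x ≠ b → y ≠ b → x ≤ v → y ≤ v → x ≤ y ∨ y ≤ x := by
    intro x y hx hy hxv hyv
    by_contra! hxy
    obtain ⟨r, hr, -⟩ := exists_isJoinPair hxv hyv hxy.1 hxy.2
    have := h.only _ _ _ hr
    tauto
  have perm₁₂ : ∀ x y z, IsN6Config x y z b v → IsN6Config y x z b v := fun x y z h =>
    ⟨h.snd, h.fst, h.thd, h.ne₁₂.symm, h.ne₂₃, h.ne₁₃, fun p q r hr => by
      have := h.only p q r hr; tauto⟩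
  have perm₂₃ : ∀ x y z, IsN6Config x y z b v → IsN6Config x z y b v := fun x y z h =>
    ⟨h.fst, h.thd, h.snd, h.ne₁₃, h.ne₁₂, h.ne₂₃.symm, fun p q r hr => by
      have := h.only p q r hr; tauto⟩
  have sorted : ∃ x y z, IsN6Config x y z b v ∧ x ≤ y ∧ y ≤ z := by
    have c12 := chain a₁ a₂ h.fst.ne h.snd.ne h.fst.left_le h.snd.left_le
    have c13 := chain a₁ a₃ h.fst.ne h.thd.ne h.fst.left_le h.thd.left_le
    have c23 := chain a₂ a₃ h.snd.ne h.thd.ne h.snd.left_le h.thd.left_le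
    rcases c12 with c12 | c12 <;> rcases c23 with c23 | c23
    · exact ⟨_, _, _, h, c12, c23⟩
    · rcases c13 with c13 | c13
      · exact ⟨_, _, _, perm₂₃ _ _ _ h, c13, c23⟩
      · exact ⟨_, _, _, perm₁₂ _ _ _ (perm₂₃ _ _ _ h), c13, c12⟩
    · rcases c13 with c13 | c13
      · exact ⟨_, _, _, perm₁₂ _ _ _ h, c12, c13⟩
      · exact ⟨_, _, _, perm₂₃ _ _ _ (perm₁₂ _ _ _ h), c23, c13⟩
    · exact ⟨_, _, _, perm₁₂ _ _ _ (perm₂₃ _ _ _ (perm₁₂ _ _ _ h)), c23, c12⟩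
  clear h
  obtain ⟨x, y, z, h, hxy, hyz⟩ := sorted
  have hbv := h.fst.right_le
  have below : ∀ t, t ≤ b → t ≠ b → t ≤ x := by
    intro t ht htb
    rcases chain t x htb h.fst.ne (ht.trans hbv) h.fst.left_le with h1 | h1
    exacts [h1, (h.fst.1 (h1.trans ht)).elim]
  have meet : ∀ t, x ≤ t → ¬ b ≤ t → t ⊓ b = x ⊓ b := fun t hxt hbt =>
    le_antisymm (le_inf (below _ inf_le_right fun e => hbt (inf_eq_right.1 e)) inf_le_right)
      (inf_le_inf_right _ hxt)
  have hy : y ⊓ b = x ⊓ b := meet y hxy h.snd.2.1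
  have hz : z ⊓ b = x ⊓ b := meet z (hxy.trans hyz) h.thd.2.1
  have hux : x ⊓ b ≠ x := fun e => h.fst.1 (inf_eq_left.1 e)
  have hub : x ⊓ b ≠ b := fun e => h.fst.2.1 (inf_eq_right.1 e)
  have key : ∀ p q r, IsJoinPair p q r → p ⊓ q = x ⊓ b ∧ r = v := by
    intro p q r hr
    rcases h.only p q r hr with ⟨rfl, rfl | rfl | rfl⟩ | ⟨rfl, rfl | rfl | rfl⟩
    exacts [⟨inf_comm _ _, hr.symm.unique h.fst⟩, ⟨(inf_comm _ _).trans hy, hr.symm.unique h.snd⟩,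
      ⟨(inf_comm _ _).trans hz, hr.symm.unique h.thd⟩, ⟨rfl, hr.unique h.fst⟩,
      ⟨hy, hr.unique h.snd⟩, ⟨hz, hr.unique h.thd⟩]
  have hxv := h.fst.left_le
  have hyv := h.snd.left_le
  have hzv := h.thd.left_le
  have hX : ∀ t ∈ ({x ⊓ b, x, y, z, b, v} : Set α), x ⊓ b ≤ t ∧ t ≤ v := by
    rintro t (rfl | rfl | rfl | rfl | rfl | rfl)
    exacts [⟨le_rfl, inf_le_left.trans hxv⟩, ⟨inf_le_left, hxv⟩, ⟨inf_le_left.trans hxy, hyv⟩,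
      ⟨inf_le_left.trans (hxy.trans hyz), hzv⟩, ⟨inf_le_right, hbv⟩,
      ⟨inf_le_left.trans hxv, le_rfl⟩]
  refine ⟨{x ⊓ b, x, y, z, b, v}, ?_, x ⊓ b, x, y, z, b, v, rfl, inf_le_left.lt_of_ne hux,
    hxy.lt_of_ne h.ne₁₂, hyz.lt_of_ne h.ne₂₃, hzv.lt_of_ne h.thd.left_ne,
    inf_le_right.lt_of_ne hub, hbv.lt_of_ne h.fst.right_ne, h.fst.1, h.fst.2.1, h.snd.1, h.snd.2.1,
    h.thd.1, h.thd.2.1, rfl, hy, hz, h.fst.2.2, h.snd.2.2, h.thd.2.2⟩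
  refine isNucleus_of_isJoinPair (u := x ⊓ b) (x₀ := x) (by simp) hux.symm (by simp)
    (fun t ht => (hX t ht).1) ?_ (fun p q r hr => ⟨(key p q r hr).1, by simp [(key p q r hr).2]⟩)
    (fun t ht => ⟨_, _, _, h.fst, (hX t ht).2⟩)
  intro s hs t hut hts
  have htv := hts.trans (hX s hs).2
  by_cases htb : t ≤ b
  · by_cases e : t = b
    · simp [e]
    · simp [le_antisymm (le_inf (below t htb e) htb) hut]
  by_cases hbt : b ≤ t
  · rcases chain t x (fun e => htb e.le) h.fst.ne htv hxv with h1 | h1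
    · exact (h.fst.2.1 (hbt.trans h1)).elim
    · simp [le_antisymm htv (h.fst.le h1 hbt)]
  obtain ⟨r, hr, -⟩ := exists_isJoinPair htv hbv htb hbt
  have := h.only _ _ _ hr
  have := hr.ne
  simp
  tauto

end Nucleus

/-- If |Con(S)| < 26·2^(n-6) then |Con(S)| ≤ 25·2^(n-6); moreover equality
|Con(S)| = 25·2^(n-6) holds iff S is a quasi-tree semilattice whose nucleus is
F or N₆ (all multiplied through by 2^6). -/
theorem numCong_fourth_gap {α : Type*} [SemilatticeInf α] [OrderBot α] [Fintype α]
    (hn : 2 ≤ Fintype.card α)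
    (h : 2 ^ 6 * numCong α < 26 * 2 ^ Fintype.card α) :
    2 ^ 6 * numCong α ≤ 25 * 2 ^ Fintype.card α ∧
    (2 ^ 6 * numCong α = 25 * 2 ^ Fintype.card α ↔
      ∃ X : Set α, IsNucleus X ∧ (IsFNucleus X ∨ IsN6Nucleus X)) := by
  have hcount := two_mul_numCong (α := α)
  have hconfig : (∃ X : Set α, IsNucleus X ∧ (IsFNucleus X ∨ IsN6Nucleus X)) ↔
      (∃ a b c v w : α, IsFConfig a b c v w) ∨ ∃ a₁ a₂ a₃ b v : α, IsN6Config a₁ a₂ a₃ b v := by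
    constructor
    · rintro ⟨X, hX, hF | hN⟩
      · exact .inl (hX.exists_isFConfig hF)
      · exact .inr (hX.exists_isN6Config hN)
    · rintro (⟨a, b, c, v, w, hF⟩ | ⟨a₁, a₂, a₃, b, v, hN⟩)
      · obtain ⟨X, hX, hXF⟩ := hF.exists_isNucleus
        exact ⟨X, hX, .inl hXF⟩
      · obtain ⟨X, hX, hXN⟩ := hN.exists_isNucleus
        exact ⟨X, hX, .inr hXN⟩
  have heq : ((∃ a b c v w : α, IsFConfig a b c v w) ∨
      ∃ a₁ a₂ a₃ b v : α, IsN6Config a₁ a₂ a₃ b v) →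
      numJoinClosed α * 32 = 25 * 2 ^ Fintype.card α := by
    rintro (⟨a, b, c, v, w, hF⟩ | ⟨a₁, a₂, a₃, b, v, hN⟩)
    exacts [hF.numJoinClosed_eq, hN.numJoinClosed_eq]
  rw [hconfig]
  rcases numJoinClosed_lt_or_config (α := α) (by omega) with hlt | hc
  · refine ⟨by omega, fun e => by omega, fun hc => ?_⟩
    have := heq hc
    omega
  · have := heq hc
    exact ⟨by omega, fun _ => hc, fun _ => by omega⟩
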